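/- arXiv:2011.13474 — 3 statements merged into one kernel-verified Lean document; each statement's English description precedes it below -/
import Mathlib

section
/- Let (Ω, ℱ, μ) be a probability space, β > 0 a real number, and X : Ω → ℝ a measurable random variable with 0 ≤ X ≤ β² almost surely. Then the series ∑_{k=0}^∞ c_k ∫ ((X − β²)/β²)^k dμ converges absolutely and ∫ √X dμ = β · ∑_{k=0}^∞ c_k ∫ ((X − β²)/β²)^k dμ, where c_k = ((−1)^{k+1} (2k)!) / (4^k (k!)^2 (2k − 1)). -/
open MeasureTheory

/-- The coefficient sequence of the binomial series for the square root:
`c_k = ((−1)^{k+1} (2k)!) / (4^k (k!)^2 (2k − 1))`. -/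
noncomputable def sqrtCoeff (k : ℕ) : ℝ :=
  ((-1 : ℝ) ^ (k + 1) * (Nat.factorial (2 * k))) /
    ((4 : ℝ) ^ k * ((Nat.factorial k : ℝ)) ^ 2 * (2 * (k : ℝ) - 1))

theorem sqrtCoeff_succ (k : ℕ) :
    sqrtCoeff (k + 1) * ((k : ℝ) + 1) = sqrtCoeff k * (1 / 2 - k) := by
  have h₁ : (2 * (k : ℝ) - 1) ≠ 0 := by
    have h : (2 * (k : ℤ) - 1) ≠ 0 := by omega
    exact_mod_cast h
  have h₂ : (2 * ((k : ℝ) + 1) - 1) ≠ 0 := by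
    have : (0 : ℝ) ≤ k := k.cast_nonneg
    linarith
  have h₃ : (k : ℝ) + 1 ≠ 0 := by positivity
  have h₄ : (k.factorial : ℝ) ≠ 0 := by positivity
  simp only [sqrtCoeff, show 2 * (k + 1) = 2 * k + 1 + 1 by ring, Nat.factorial_succ]
  push_cast
  field_simp
  ring

theorem sqrtCoeff_zero : sqrtCoeff 0 = 1 := by
  norm_num [sqrtCoeff]

theorem sqrtCoeff_eq_choose (k : ℕ) : sqrtCoeff k = Ring.choose (1 / 2 : ℝ) k := by
  induction k with
  | zero => rw [sqrtCoeff_zero, Ring.choose_zero_right]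
  | succ k ih =>
    have h := Ring.choose_smul_choose (1 / 2 : ℝ) (Nat.le_succ k)
    rw [Nat.succ_eq_add_one, Nat.choose_succ_self_right, Nat.add_sub_cancel_left,
      Ring.choose_one_right, ← ih, ← sqrtCoeff_succ, nsmul_eq_mul, mul_comm] at h
    push_cast at h
    exact (mul_right_cancel₀ (by positivity) h).symm

theorem sum_range_abs_sqrtCoeff (n : ℕ) :
    ∑ i ∈ Finset.range (n + 2), |sqrtCoeff i| = 2 - (2 * n + 1) * |sqrtCoeff (n + 1)| := by
  induction n with
  | zero =>
    have h := sqrtCoeff_succ 0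
    norm_num [sqrtCoeff_zero] at h
    norm_num [Finset.sum_range_succ, sqrtCoeff_zero, h]
  | succ n ih =>
    have h := congrArg abs (sqrtCoeff_succ (n + 1))
    have hn : (1 / 2 - ((n + 1 : ℕ) : ℝ)) ≤ 0 := by
      have : (0 : ℝ) ≤ n := n.cast_nonneg
      push_cast
      linarith
    rw [abs_mul, abs_mul, abs_of_nonpos hn,
      abs_of_nonneg (show (0 : ℝ) ≤ ((n + 1 : ℕ) : ℝ) + 1 by positivity)] at h
    rw [show n + 1 + 2 = n + 1 + 1 + 1 by ring, Finset.sum_range_succ, ih]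
    push_cast at h ⊢
    linarith

theorem summable_abs_sqrtCoeff : Summable fun k => |sqrtCoeff k| := by
  refine summable_of_sum_range_le (c := 2) (fun _ => abs_nonneg _) fun n => ?_
  calc ∑ i ∈ Finset.range n, |sqrtCoeff i|
      ≤ ∑ i ∈ Finset.range (n + 2), |sqrtCoeff i| :=
        Finset.sum_le_sum_of_subset_of_nonneg (Finset.range_mono (by omega))
          fun _ _ _ => abs_nonneg _
    _ ≤ 2 := by
        rw [sum_range_abs_sqrtCoeff]
        exact sub_le_self _ (by positivity)

theorem norm_sqrtCoeff_mul_pow_le (k : ℕ) {y : ℝ} (hy : y ∈ Set.Icc (-1 : ℝ) 1) :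
    ‖sqrtCoeff k * y ^ k‖ ≤ |sqrtCoeff k| := by
  rw [norm_mul, norm_pow, Real.norm_eq_abs, Real.norm_eq_abs]
  exact mul_le_of_le_one_right (abs_nonneg _) (pow_le_one₀ (abs_nonneg _) (abs_le.2 hy))

theorem tsum_sqrtCoeff_mul_pow_of_mem_Ioo {y : ℝ} (hy : y ∈ Set.Ioo (-1 : ℝ) 1) :
    ∑' k, sqrtCoeff k * y ^ k = √(1 + y) := by
  have h := (Real.one_add_rpow_hasFPowerSeriesOnBall_zero (a := 1 / 2)).hasSum (y := y) (by
    rw [← ENNReal.ofReal_one, Metric.eball_ofReal]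
    simpa [abs_lt] using hy)
  rw [Real.sqrt_eq_rpow, ← zero_add y, ← h.tsum_eq]
  simp [sqrtCoeff_eq_choose, binomialSeries, mul_comm]

/-- The binomial series of the square root converges on the closed interval `[-1, 1]`. -/
theorem hasSum_sqrtCoeff_mul_pow {y : ℝ} (hy : y ∈ Set.Icc (-1 : ℝ) 1) :
    HasSum (fun k => sqrtCoeff k * y ^ k) √(1 + y) := by
  have hcont : ContinuousOn (fun y : ℝ => ∑' k, sqrtCoeff k * y ^ k) (Set.Icc (-1) 1) :=
    continuousOn_tsum (fun k => by fun_prop) summable_abs_sqrtCoeff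
      fun k _ hy => norm_sqrtCoeff_mul_pow_le k hy
  have heq : Set.EqOn (fun y : ℝ => ∑' k, sqrtCoeff k * y ^ k) (fun y => √(1 + y))
      (Set.Icc (-1) 1) :=
    Set.EqOn.of_subset_closure (s := Set.Ioo (-1) 1)
      (fun _ hy => tsum_sqrtCoeff_mul_pow_of_mem_Ioo hy)
      hcont (by fun_prop) Set.Ioo_subset_Icc_self (by rw [closure_Ioo (by norm_num)])
  rw [← show ∑' k, sqrtCoeff k * y ^ k = √(1 + y) from heq hy]
  exact (summable_abs_sqrtCoeff.of_norm_bounded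
    fun k => norm_sqrtCoeff_mul_pow_le k hy).hasSum

/-- If `0 ≤ X ≤ β²` a.s. on a probability space, then the series
`∑_k c_k ∫ ((X − β²)/β²)^k dμ` converges absolutely and
`∫ √X dμ = β · ∑_k c_k ∫ ((X − β²)/β²)^k dμ`. -/
theorem integral_sqrt_eq_tsum_binomial
    {Ω : Type*} [MeasurableSpace Ω] (μ : Measure Ω) [IsProbabilityMeasure μ]
    (β : ℝ) (hβ : 0 < β) (X : Ω → ℝ) (hX : Measurable X)
    (hXbound : ∀ᵐ ω ∂μ, 0 ≤ X ω ∧ X ω ≤ β ^ 2) :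
    Summable (fun k : ℕ => |sqrtCoeff k * ∫ ω, ((X ω - β ^ 2) / β ^ 2) ^ k ∂μ|) ∧
      (∫ ω, Real.sqrt (X ω) ∂μ) =
        β * ∑' k : ℕ, sqrtCoeff k * ∫ ω, ((X ω - β ^ 2) / β ^ 2) ^ k ∂μ := by
  have hβ2 : 0 < β ^ 2 := by positivity
  have hmem : ∀ᵐ ω ∂μ, (X ω - β ^ 2) / β ^ 2 ∈ Set.Icc (-1 : ℝ) 1 := by
    filter_upwards [hXbound] with ω hω
    rw [Set.mem_Icc, le_div_iff₀ hβ2, div_le_iff₀ hβ2]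
    constructor <;> linarith [hω.1, hω.2]
  have hsum : HasSum (fun k => ∫ ω, sqrtCoeff k * ((X ω - β ^ 2) / β ^ 2) ^ k ∂μ)
      (∫ ω, √(1 + (X ω - β ^ 2) / β ^ 2) ∂μ) := by
    refine hasSum_integral_of_dominated_convergence (fun k _ => |sqrtCoeff k|)
      (fun k => by fun_prop) (fun k => ?_) (.of_forall fun _ => summable_abs_sqrtCoeff)
      (integrable_const _) ?_
    · filter_upwards [hmem] with ω hω using norm_sqrtCoeff_mul_pow_le k hω
    · filter_upwards [hmem] with ω hω using hasSum_sqrtCoeff_mul_pow hω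
  simp only [integral_const_mul] at hsum
  refine ⟨hsum.summable.abs, ?_⟩
  rw [hsum.tsum_eq, ← integral_const_mul]
  refine integral_congr_ae (.of_forall fun ω => ?_)
  have h : 1 + (X ω - β ^ 2) / β ^ 2 = X ω / β ^ 2 := by
    field_simp
    ring
  simp only [h]
  rw [Real.sqrt_div' _ hβ2.le, Real.sqrt_sq hβ.le, mul_div_cancel₀ _ hβ.ne']
end

section
/- Let μ₂, μ₃ be real numbers, not both zero. Set U = √(μ₂² + μ₃²), W = √(2(μ₂² + μ₃² − μ₂μ₃)(μ₂² + μ₃²)), Z = √(2(μ₂² + μ₃² − μ₂μ₃)), and V = μ₂ − μ₃. Let P₁ be the 3×2 matrix with rows (0, U²/W), (μ₂/U, −Vμ₃/W), (μ₃/U, Vμ₂/W), and let R be the 2×2 upper-triangular matrix with rows (U, (μ₂ + μ₃)/U) and (0, Z/U). Then the 3×2 matrix A with rows (0, 1), (μ₂, 1), (μ₃, 1) satisfies A = P₁ · R; moreover det R = Z. -/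
open Matrix

/-- QR factorization of the constraint matrix `A` (Section 3.2): `A = P₁ · R`,
with `R` upper triangular, and `det R = Z`. -/
theorem qr_factorization_constraint_matrix (μ₂ μ₃ : ℝ) (h : ¬(μ₂ = 0 ∧ μ₃ = 0))
    (U W Z V : ℝ)
    (hU : U = Real.sqrt (μ₂ ^ 2 + μ₃ ^ 2))
    (hW : W = Real.sqrt (2 * (μ₂ ^ 2 + μ₃ ^ 2 - μ₂ * μ₃) * (μ₂ ^ 2 + μ₃ ^ 2)))
    (hZ : Z = Real.sqrt (2 * (μ₂ ^ 2 + μ₃ ^ 2 - μ₂ * μ₃)))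
    (hV : V = μ₂ - μ₃)
    (P₁ : Matrix (Fin 3) (Fin 2) ℝ)
    (hP₁ : P₁ = !![0, U ^ 2 / W;
                   μ₂ / U, -(V * μ₃) / W;
                   μ₃ / U, V * μ₂ / W])
    (R : Matrix (Fin 2) (Fin 2) ℝ)
    (hR : R = !![U, (μ₂ + μ₃) / U;
                 0, Z / U])
    (A : Matrix (Fin 3) (Fin 2) ℝ)
    (hA : A = !![0, 1;
                 μ₂, 1;
                 μ₃, 1]) :
    A = P₁ * R ∧ R.det = Z := by
  have hn : 0 < μ₂ ^ 2 + μ₃ ^ 2 := by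
    rcases not_and_or.mp h with h | h <;> positivity
  have hm : 0 < 2 * (μ₂ ^ 2 + μ₃ ^ 2 - μ₂ * μ₃) := by
    nlinarith [sq_nonneg (μ₂ - μ₃)]
  have hU₀ : U ≠ 0 := hU ▸ (Real.sqrt_pos.mpr hn).ne'
  have hZ₀ : Z ≠ 0 := hZ ▸ (Real.sqrt_pos.mpr hm).ne'
  have hU2 : U ^ 2 = μ₂ ^ 2 + μ₃ ^ 2 := by rw [hU, Real.sq_sqrt hn.le]
  have hWZU : W = Z * U := by rw [hW, hZ, hU, Real.sqrt_mul hm.le]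
  clear hU hZ hW
  subst hWZU hV hP₁ hR hA
  constructor
  · ext i j
    fin_cases i <;> fin_cases j <;> simp [Matrix.mul_apply, Fin.sum_univ_two] <;>
      field_simp
    all_goals linear_combination hU2
  · rw [Matrix.det_fin_two_of]
    field_simp
    ring
end

section
/- Let μ₂, μ₃ be real numbers, not both zero, and let k be a real number. Set U = √(μ₂² + μ₃²), W = √(2(μ₂² + μ₃² − μ₂μ₃)(μ₂² + μ₃²)), Z = √(2(μ₂² + μ₃² − μ₂μ₃)), and V = μ₂ − μ₃. Let P be the 3×3 matrix with rows (0, U²/W, V/Z), (μ₂/U, −Vμ₃/W, μ₃/Z), (μ₃/U, Vμ₂/W, −μ₂/Z), and let A be the 3×2 matrix with rows (0, 1), (μ₂, 1), (μ₃, 1). Define F₁ = (1/Z)(kZ/U), F₂ = (1/Z)(−k(μ₂ + μ₃)/U + U), and assume F₁² + F₂² ≤ 1; set F₃ = √(1 − F₁² − F₂²) and F = (F₁, F₂, F₃). Then the vector w = P·F satisfies wᵀw = 1 and Aᵀw = (k, 1)ᵀ. -/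
open Matrix

/-- Feasibility of the candidate portfolio-weight vector `w = P·F` of Theorem 8:
`wᵀw = 1` and `Aᵀw = (k, 1)ᵀ`. -/
theorem weight_vector_feasible (μ₂ μ₃ : ℝ) (h : ¬(μ₂ = 0 ∧ μ₃ = 0)) (k : ℝ)
    (U W Z V : ℝ)
    (hU : U = Real.sqrt (μ₂ ^ 2 + μ₃ ^ 2))
    (hW : W = Real.sqrt (2 * (μ₂ ^ 2 + μ₃ ^ 2 - μ₂ * μ₃) * (μ₂ ^ 2 + μ₃ ^ 2)))
    (hZ : Z = Real.sqrt (2 * (μ₂ ^ 2 + μ₃ ^ 2 - μ₂ * μ₃)))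
    (hV : V = μ₂ - μ₃)
    (P : Matrix (Fin 3) (Fin 3) ℝ)
    (hP : P = !![0, U ^ 2 / W, V / Z;
                 μ₂ / U, -(V * μ₃) / W, μ₃ / Z;
                 μ₃ / U, V * μ₂ / W, -μ₂ / Z])
    (A : Matrix (Fin 3) (Fin 2) ℝ)
    (hA : A = !![0, 1;
                 μ₂, 1;
                 μ₃, 1])
    (F₁ F₂ : ℝ)
    (hF₁ : F₁ = (1 / Z) * (k * Z / U))
    (hF₂ : F₂ = (1 / Z) * (-(k * (μ₂ + μ₃)) / U + U))
    (hF : F₁ ^ 2 + F₂ ^ 2 ≤ 1)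
    (F₃ : ℝ) (hF₃ : F₃ = Real.sqrt (1 - F₁ ^ 2 - F₂ ^ 2))
    (F : Fin 3 → ℝ) (hFvec : F = ![F₁, F₂, F₃])
    (w : Fin 3 → ℝ) (hw : w = P.mulVec F) :
    w ⬝ᵥ w = 1 ∧ Aᵀ.mulVec w = ![k, 1] := by
  have hs : 0 < μ₂ ^ 2 + μ₃ ^ 2 := by
    by_contra! hn
    exact h ⟨by nlinarith [sq_nonneg μ₂, sq_nonneg μ₃], by nlinarith [sq_nonneg μ₂, sq_nonneg μ₃]⟩
  have hd : 0 < 2 * (μ₂ ^ 2 + μ₃ ^ 2 - μ₂ * μ₃) := by nlinarith [sq_nonneg (μ₂ - μ₃)]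
  have hU0 : U ≠ 0 := hU ▸ (Real.sqrt_pos.2 hs).ne'
  have hZ0 : Z ≠ 0 := hZ ▸ (Real.sqrt_pos.2 hd).ne'
  have hUsq : U ^ 2 = μ₂ ^ 2 + μ₃ ^ 2 := by rw [hU, Real.sq_sqrt hs.le]
  have hZsq : Z ^ 2 = U ^ 2 + V ^ 2 := by
    rw [hUsq, hV, hZ, Real.sq_sqrt hd.le]; ring
  have hWZU : W = Z * U := by rw [hW, hZ, hU, Real.sqrt_mul hd.le]
  have hF₃sq : F₁ ^ 2 + F₂ ^ 2 + F₃ ^ 2 = 1 := by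
    rw [hF₃, Real.sq_sqrt (by linarith)]; ring
  have hF₁U : U * F₁ = k := by rw [hF₁]; field_simp
  have hF₂U : Z * U * F₂ = U ^ 2 - k * (μ₂ + μ₃) := by
    rw [hF₂]; field_simp; ring
  have horth : Pᵀ * P = 1 := by
    have hμ₂ : μ₂ ^ 2 = U ^ 2 - μ₃ ^ 2 := by linarith
    ext i j
    fin_cases i <;> fin_cases j <;>
      simp [hP, hWZU, Matrix.mul_apply, Fin.sum_univ_three] <;> field_simp <;>
      grind
  have hw₀ : w 0 = U / Z * F₂ + V / Z * F₃ := by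
    rw [hw, hP, hFvec, hWZU]
    have hdiv : U ^ 2 / (Z * U) = U / Z := by field_simp
    simp [Matrix.mulVec, dotProduct, Fin.sum_univ_three, hdiv]
  have hw₁ : w 1 = μ₂ / U * F₁ - V * μ₃ / (Z * U) * F₂ + μ₃ / Z * F₃ := by
    rw [hw, hP, hFvec, hWZU]
    simp [Matrix.mulVec, dotProduct, Fin.sum_univ_three]
    ring
  have hw₂ : w 2 = μ₃ / U * F₁ + V * μ₂ / (Z * U) * F₂ - μ₂ / Z * F₃ := by
    rw [hw, hP, hFvec, hWZU]
    simp [Matrix.mulVec, dotProduct, Fin.sum_univ_three]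
    ring
  have hreturn : μ₂ * w 1 + μ₃ * w 2 = k := by
    rw [hw₁, hw₂, ← hF₁U]
    field_simp
    linear_combination -F₁ * Z * hUsq
  have hbudget : w 0 + w 1 + w 2 = 1 := by
    rw [hw₀, hw₁, hw₂]
    field_simp
    apply mul_left_cancel₀ hU0
    linear_combination Z * (μ₂ + μ₃) * hF₁U + Z * hF₂U - U * F₂ * hZsq
      + (U ^ 2 * F₃ - U * V * F₂) * hV
  constructor
  · rw [hw, Matrix.dotProduct_mulVec, Matrix.vecMul_mulVec, ← Matrix.dotProduct_mulVec, horth,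
      Matrix.one_mulVec, hFvec, ← hF₃sq]
    simp [dotProduct, Fin.sum_univ_three]
    ring
  · ext i
    fin_cases i
    · simpa [hA, Matrix.mulVec, dotProduct, Fin.sum_univ_three] using hreturn
    · simpa [hA, Matrix.mulVec, dotProduct, Fin.sum_univ_three] using hbudget
end
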